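/- Let F ⊆ P²(F₄) be a four-point subset no three of whose points are collinear. Then the group of permutations σ of the 21-point set P²(F₄) satisfying σ(C_F) = C_F has order 1152. -/

import Mathlib

/-- An `F`-rational line in the projective plane over `F`: the vanishing set of a nonzero
linear functional. -/
def IsProjLine (F : Type*) [Field F] (L : Set (Projectivization F (Fin 3 → F))) : Prop :=
  ∃ φ : (Fin 3 → F) →ₗ[F] F, φ ≠ 0 ∧ L = {P | φ P.rep = 0}

/-- A set of points of the projective plane is collinear if it is contained in a line. -/
def CollinSet (F : Type*) [Field F] (T : Set (Projectivization F (Fin 3 → F))) : Prop :=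
  ∃ L, IsProjLine F L ∧ T ⊆ L

/-- The Dolgachev–Kondō code `C_DK ⊆ Pow(P²(F₄))`: the `F₂`-linear span of the (indicator
functions of the) point sets of the `F₄`-rational lines. -/
noncomputable def CDK (F : Type*) [Field F] :
    Submodule (ZMod 2) (Projectivization F (Fin 3 → F) → ZMod 2) :=
  Submodule.span (ZMod 2)
    {w | ∃ L : Set (Projectivization F (Fin 3 → F)), IsProjLine F L ∧
      w = Set.indicator L (fun _ => (1 : ZMod 2))}

/-- The code `C_F = {w ∈ C_DK : |w ∩ F| even}`: the condition `|w ∩ F| ≡ 0 (mod 2)` is the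
vanishing of the `F₂`-linear functional `w ↦ ∑_{x ∈ F} w(x)`. -/
noncomputable def CF (F : Type*) [Field F] (Fs : Finset (Projectivization F (Fin 3 → F))) :
    Submodule (ZMod 2) (Projectivization F (Fin 3 → F) → ZMod 2) :=
  CDK F ⊓ LinearMap.ker (∑ x ∈ Fs, LinearMap.proj x)

/-- The field with four elements `0, 1, ω, ω²`. -/
inductive GF4
  | zero | one | omega | omegaSq
  deriving DecidableEq

namespace GF4

instance : Fintype GF4 where
  elems := {zero, one, omega, omegaSq}
  complete := by rintro ⟨⟩ <;> decide

def addFun : GF4 → GF4 → GF4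
  | zero, x => x
  | x, zero => x
  | one, one => zero
  | one, omega => omegaSq
  | one, omegaSq => omega
  | omega, one => omegaSq
  | omega, omega => zero
  | omega, omegaSq => one
  | omegaSq, one => omega
  | omegaSq, omega => one
  | omegaSq, omegaSq => zero

def mulFun : GF4 → GF4 → GF4
  | zero, _ => zero
  | _, zero => zero
  | one, x => x
  | x, one => x
  | omega, omega => omegaSq
  | omega, omegaSq => one
  | omegaSq, omega => one
  | omegaSq, omegaSq => omega

def invFun : GF4 → GF4
  | zero => zero
  | one => one
  | omega => omegaSq
  | omegaSq => omega

instance : Zero GF4 := ⟨zero⟩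
instance : One GF4 := ⟨one⟩
instance : Add GF4 := ⟨addFun⟩
instance : Mul GF4 := ⟨mulFun⟩
instance : Neg GF4 := ⟨id⟩
instance : Inv GF4 := ⟨invFun⟩

instance : Field GF4 where
  add_assoc := by decide
  zero_add := by decide
  add_zero := by decide
  add_comm := by decide
  neg_add_cancel := by decide
  mul_assoc := by decide
  one_mul := by decide
  mul_one := by decide
  zero_mul := by decide
  mul_zero := by decide
  mul_comm := by decide
  left_distrib := by decide
  right_distrib := by decide
  exists_pair_ne := ⟨zero, one, by decide⟩
  mul_inv_cancel := by decide
  inv_zero := rfl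
  nsmul := nsmulRec
  zsmul := zsmulRec
  nnqsmul := _
  nnqsmul_def := fun _ _ => rfl
  qsmul := _
  qsmul_def := fun _ _ => rfl

theorem card_eq : Fintype.card GF4 = 4 := by decide

end GF4

/-- The points of the plane: the affine points, the three directions of the net of lines
`x = c`, `y = c`, `x + y = c`, and the two remaining directions. -/
abbrev PlanePoint := (GF4 × GF4) ⊕ (Fin 3 ⊕ Fin 2)

/-- The lines of the net together with the line at infinity. -/
abbrev NetLine := (Fin 3 × GF4) ⊕ Unit

/-- All lines of the plane: those of the net, the line at infinity, and the other affine lines. -/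
abbrev PlaneLine := NetLine ⊕ (Fin 2 × GF4)

open GF4

def tangentSlope (e : Fin 2) : GF4 := if e = 0 then omega else omegaSq

/-- Homogeneous coordinates for which the affine points over the prime field are the standard
projective frame. -/
def ptVec : PlanePoint → Fin 3 → GF4
  | .inl (x, y) => ![1 + x + y, x, y]
  | .inr (.inl i) => ![![1, 0, 1], ![1, 1, 0], ![0, 1, 1]] i
  | .inr (.inr e) => ![1 + tangentSlope e, 1, tangentSlope e]

def lnVec : PlaneLine → Fin 3 → GF4
  | .inl (.inl (i, c)) => ![![c, c + 1, c], ![c, c, c + 1], ![c, c + 1, c + 1]] i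
  | .inl (.inr _) => ![1, 1, 1]
  | .inr (e, c) => ![c, c + tangentSlope e, c + 1]

def Inc (j : PlaneLine) (x : PlanePoint) : Prop :=
  ptVec x 0 * lnVec j 0 + ptVec x 1 * lnVec j 1 + ptVec x 2 * lnVec j 2 = 0

instance (j : PlaneLine) (x : PlanePoint) : Decidable (Inc j x) :=
  inferInstanceAs (Decidable (_ = _))

theorem ptVec_inj : ∀ x y : PlanePoint, ∀ c : GF4, (∀ k, ptVec x k = c * ptVec y k) → x = y := by
  decide +kernel

def lineWord (j : PlaneLine) : PlanePoint → ZMod 2 := fun x => if Inc j x then 1 else 0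

/-- The four affine points over the prime field. -/
def frame : Finset PlanePoint :=
  {.inl (0, 0), .inl (1, 0), .inl (0, 1), .inl (1, 1)}

/-- The words of even weight on `frame` in the code spanned by the lines. -/
def modelCode : Submodule (ZMod 2) (PlanePoint → ZMod 2) :=
  Submodule.span (ZMod 2) (Set.range lineWord) ⊓ LinearMap.ker (∑ x ∈ frame, LinearMap.proj x)

theorem exists_unique_line : ∀ x y : PlanePoint, x ≠ y →
    Finset.card {j : PlaneLine | Inc j x ∧ Inc j y} = 1 := by
  decide +kernel

theorem card_lines_through : ∀ x : PlanePoint, Finset.card {j : PlaneLine | Inc j x} = 5 := by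
  decide +kernel

theorem card_line : ∀ j : PlaneLine, Finset.card {x : PlanePoint | Inc j x} = 5 := by
  decide +kernel

theorem sum_lineWord_mul : ∀ j k : PlaneLine,
    ∑ x, lineWord j x * lineWord k x = ∑ x, lineWord k x := by
  decide +kernel

theorem sum_frame_lineWord_net : ∀ k : NetLine, ∑ x ∈ frame, lineWord (.inl k) x = 0 := by
  decide +kernel

theorem sum_frame_lineWord_tangent : ∀ t, ∑ x ∈ frame, lineWord (.inr t) x = 1 := by
  decide +kernel

theorem tangent_add_tangent : ∀ c d : GF4, ∃ x : PlanePoint, ∀ y,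
    lineWord (.inr (0, c)) y + lineWord (.inr (1, d)) y =
      ∑ k : NetLine, ((if Inc (.inl k) x then 1 else 0) +
        (if Inc (.inl k) (.inr (.inl 0)) then 1 else 0)) * lineWord (.inl k) y := by
  decide +kernel

theorem modelCode_eq_span :
    modelCode = Submodule.span (ZMod 2) (Set.range fun k : NetLine => lineWord (.inl k)) := by
  set S := Submodule.span (ZMod 2) (Set.range fun k : NetLine => lineWord (.inl k)) with hS
  have hmem : ∀ k : NetLine, lineWord (.inl k) ∈ S := fun k => Submodule.subset_span ⟨k, rfl⟩
  have hSker : S ≤ LinearMap.ker (∑ x ∈ frame, LinearMap.proj x) := by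
    rw [hS, Submodule.span_le]
    rintro _ ⟨k, rfl⟩
    simpa [LinearMap.sum_apply] using sum_frame_lineWord_net k
  have hpair : ∀ c d : GF4, lineWord (.inr (0, c)) + lineWord (.inr (1, d)) ∈ S := by
    intro c d
    obtain ⟨x, hx⟩ := tangent_add_tangent c d
    have : lineWord (.inr (0, c)) + lineWord (.inr (1, d)) =
        ∑ k : NetLine, (((if Inc (.inl k) x then 1 else 0) +
        (if Inc (.inl k) (.inr (.inl 0)) then 1 else 0) : ZMod 2)) • lineWord (.inl k) := by
      funext y
      simpa [Finset.sum_apply] using hx y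
    rw [this]
    exact Submodule.sum_mem _ fun k _ => Submodule.smul_mem _ _ (hmem k)
  have htangent : ∀ t, lineWord (.inr t) - lineWord (.inr (0, 0)) ∈ S := by
    rintro ⟨e, c⟩
    have hneg : ∀ v : PlanePoint → ZMod 2, -v = v := fun v => by
      funext y; exact ZMod.neg_eq_self_mod_two _
    fin_cases e
    · have := S.sub_mem (hpair c 0) (hpair 0 0)
      simpa using this
    · have := hpair 0 c
      rw [sub_eq_add_neg, hneg, add_comm]
      simpa using this
  apply le_antisymm
  · rintro w ⟨hw, hker⟩
    have hle : Submodule.span (ZMod 2) (Set.range lineWord) ≤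
        S ⊔ Submodule.span (ZMod 2) {lineWord (.inr (0, 0))} := by
      rw [Submodule.span_le]
      rintro _ ⟨k | t, rfl⟩
      · exact Submodule.mem_sup_left (hmem k)
      · rw [SetLike.mem_coe, ← sub_add_cancel (lineWord (.inr t)) (lineWord (.inr (0, 0)))]
        exact Submodule.add_mem_sup (htangent t) (Submodule.mem_span_singleton_self _)
    obtain ⟨s, hs, v, hv, rfl⟩ := Submodule.mem_sup.1 (hle hw)
    obtain ⟨a, rfl⟩ := Submodule.mem_span_singleton.1 hv
    have h1 : (∑ x ∈ frame, LinearMap.proj x : (PlanePoint → ZMod 2) →ₗ[ZMod 2] ZMod 2) s = 0 :=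
      hSker hs
    have h2 : (∑ x ∈ frame, LinearMap.proj x : (PlanePoint → ZMod 2) →ₗ[ZMod 2] ZMod 2)
        (lineWord (.inr (0, 0))) = 1 := by
      simpa [LinearMap.sum_apply] using sum_frame_lineWord_tangent (0, 0)
    have h3 : a = 0 := by
      have := LinearMap.mem_ker.1 hker
      rw [map_add, map_smul, h1, h2] at this
      simpa using this
    simpa [h3] using hs
  · refine le_inf ?_ hSker
    exact Submodule.span_mono (by rintro _ ⟨k, rfl⟩; exact ⟨_, rfl⟩)

theorem sum_lineWord_mul_of_mem {w : PlanePoint → ZMod 2}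
    (hw : w ∈ Submodule.span (ZMod 2) (Set.range lineWord)) (j : PlaneLine) :
    ∑ x, lineWord j x * w x = ∑ x, w x := by
  induction hw using Submodule.span_induction with
  | mem v hv => obtain ⟨k, rfl⟩ := hv; exact sum_lineWord_mul j k
  | zero => simp
  | add u v _ _ hu hv => simp only [Pi.add_apply, mul_add, Finset.sum_add_distrib, hu, hv]
  | smul a v _ hv =>
    simp only [Pi.smul_apply, smul_eq_mul, mul_left_comm _ a, ← Finset.mul_sum, hv]

/-- A set of five points meeting every line is a line. -/
theorem eq_line_of_blocking (T : Finset PlanePoint) (hT : T.card = 5)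
    (hmeet : ∀ j, ∃ x ∈ T, Inc j x) : ∃ j, T = Finset.univ.filter (Inc j) := by
  obtain ⟨p, hp, q, hq, hpq⟩ := Finset.one_lt_card.1 (by omega : 1 < T.card)
  obtain ⟨j, hj⟩ := Finset.card_pos.1 (by rw [exists_unique_line p q hpq]; norm_num)
  rw [Finset.mem_filter] at hj
  obtain ⟨-, hjp, hjq⟩ := hj
  refine ⟨j, (Finset.eq_of_subset_of_card_le ?_ ?_).symm⟩
  · intro x hx
    by_contra hxT
    have hjx : Inc j x := (Finset.mem_filter.1 hx).2
    have hcount : ∑ k : PlaneLine with Inc k x, (T.filter (Inc k)).card = 5 := by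
      simp only [Finset.card_filter]
      rw [Finset.sum_comm, ← hT, Finset.card_eq_sum_ones]
      refine Finset.sum_congr rfl fun t ht => ?_
      rw [← Finset.card_filter, Finset.filter_filter]
      exact exists_unique_line x t (by rintro rfl; exact hxT ht)
    have hlt : ∑ k : PlaneLine with Inc k x, 1 <
        ∑ k : PlaneLine with Inc k x, (T.filter (Inc k)).card := by
      refine Finset.sum_lt_sum (fun k _ => ?_) ⟨j, by simpa using hjx, ?_⟩
      · obtain ⟨t, ht, hkt⟩ := hmeet k
        exact Finset.card_pos.2 ⟨t, Finset.mem_filter.2 ⟨ht, hkt⟩⟩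
      · exact Finset.one_lt_card.2 ⟨p, by simp [hp, hjp], q, by simp [hq, hjq], hpq⟩
    rw [hcount, ← Finset.card_eq_sum_ones, card_lines_through] at hlt
    exact lt_irrefl _ hlt
  · rw [hT]; exact (card_line j).ge

/-- The permutation maps lines of the net, completed by the line at infinity, to such lines. -/
def PreservesNet (σ : Equiv.Perm PlanePoint) : Prop :=
  ∀ k : NetLine, ∃ k' : NetLine, ∀ x, Inc (.inl k) (σ x) ↔ Inc (.inl k') x

theorem exists_netLine_of_mem (T : Finset PlanePoint) (hT : T.card = 5)
    (hmem : (fun x => if x ∈ T then (1 : ZMod 2) else 0) ∈ modelCode) :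
    ∃ k : NetLine, ∀ x, x ∈ T ↔ Inc (.inl k) x := by
  obtain ⟨j, rfl⟩ := eq_line_of_blocking T hT fun j => by
    by_contra! hne
    have h := sum_lineWord_mul_of_mem hmem.1 j
    rw [Finset.sum_eq_zero, Finset.sum_boole, Finset.filter_mem_eq_inter, Finset.univ_inter,
      hT] at h
    · exact absurd h (by decide)
    · intro x _
      by_cases hx : x ∈ T
      · simp [lineWord, hne x hx]
      · simp [hx]
  obtain k | t := j
  · exact ⟨k, by simp⟩
  · have h0 := sum_frame_lineWord_tangent t
    have h1 := LinearMap.mem_ker.1 hmem.2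
    simp only [LinearMap.sum_apply, LinearMap.proj_apply, Finset.mem_filter, Finset.mem_univ,
      true_and] at h1
    exact absurd (h0.symm.trans h1) (by decide)

theorem map_modelCode_eq_iff (σ : Equiv.Perm PlanePoint) :
    Submodule.map (LinearMap.funLeft (ZMod 2) (ZMod 2) σ) modelCode = modelCode ↔
      PreservesNet σ := by
  constructor
  · intro h k
    have hmem : lineWord (.inl k) ∘ σ ∈ modelCode := by
      rw [← h]
      refine ⟨lineWord (.inl k), ?_, rfl⟩
      rw [modelCode_eq_span]
      exact Submodule.subset_span ⟨k, rfl⟩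
    obtain ⟨k', hk'⟩ := exists_netLine_of_mem (Finset.univ.filter fun x => Inc (.inl k) (σ x))
      (by
        rw [← card_line (.inl k)]
        exact Finset.card_equiv σ (by simp))
      (by
        convert hmem using 2 with x
        simp [lineWord])
    exact ⟨k', by simpa using hk'⟩
  · intro h
    refine Submodule.eq_of_le_of_finrank_eq ?_ ?_
    · rw [modelCode_eq_span, Submodule.map_span, Submodule.span_le]
      rintro _ ⟨_, ⟨k, rfl⟩, rfl⟩
      obtain ⟨k', hk'⟩ := h k
      refine Submodule.subset_span ⟨k', ?_⟩
      funext x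
      simp [lineWord, LinearMap.funLeft, hk' x]
    · exact LinearEquiv.finrank_map_eq (LinearEquiv.funCongrLeft (ZMod 2) (ZMod 2) σ) modelCode

def netCoord (i : Fin 3) (p : GF4 × GF4) : GF4 :=
  ![p.1, p.2, p.1 + p.2] i

theorem inc_net_affine : ∀ (i : Fin 3) (c : GF4) (p : GF4 × GF4),
    Inc (.inl (.inl (i, c))) (.inl p) ↔ netCoord i p = c := by
  decide +kernel

theorem inc_net_direction : ∀ (i : Fin 3) (c : GF4) (k : Fin 3),
    Inc (.inl (.inl (i, c))) (.inr (.inl k)) ↔ i = k := by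
  decide +kernel

theorem not_inc_net_tangent : ∀ (i : Fin 3) (c : GF4) (e : Fin 2),
    ¬ Inc (.inl (.inl (i, c))) (.inr (.inr e)) := by
  decide +kernel

theorem not_inc_infinity_affine : ∀ (p : GF4 × GF4), ¬ Inc (.inl (.inr ())) (.inl p) := by
  decide +kernel

theorem inc_infinity : ∀ y : Fin 3 ⊕ Fin 2, Inc (.inl (.inr ())) (.inr y) := by
  decide +kernel

theorem netLine_injective : ∀ k k' : NetLine,
    (∀ x, Inc (.inl k) x ↔ Inc (.inl k') x) → k = k' := by
  decide +kernel

/-- The number of lines of the net, completed by the line at infinity, through a point. -/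
def netDegree (x : PlanePoint) : ℕ := Finset.card {k : NetLine | Inc (.inl k) x}

theorem netDegree_affine : ∀ p, netDegree (.inl p) = 3 := by decide +kernel

theorem netDegree_direction : ∀ i, netDegree (.inr (.inl i)) = 5 := by decide +kernel

theorem netDegree_tangent : ∀ e, netDegree (.inr (.inr e)) = 1 := by decide +kernel

theorem netCoord_sum : ∀ p, netCoord 0 p + netCoord 1 p + netCoord 2 p = 0 := by decide +kernel

theorem netCoord_ext : ∀ p q, (∀ i, netCoord i p = netCoord i q) → p = q := by decide +kernel

theorem exists_netCoord_eq : ∀ i c, ∃ p, netCoord i p = c := by decide +kernel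

theorem netCoord_mk : ∀ a b c : GF4, a + b + c = 0 → ∀ k, netCoord k (a, b) = ![a, b, c] k := by
  decide +kernel

/-- The autotopisms of the addition table of the field with four elements, parametrised by their
first component and a translation. -/
def autotopism (f : Equiv.Perm GF4) (t : GF4) : Fin 3 → Equiv.Perm GF4 :=
  ![f, f.trans (Equiv.addRight t), f.trans (Equiv.addRight (f 0 + t))]

theorem autotopism_sum : ∀ (f : Equiv.Perm GF4) (t : GF4) (p : GF4 × GF4),
    autotopism f t 0 (netCoord 0 p) + autotopism f t 1 (netCoord 1 p) +
      autotopism f t 2 (netCoord 2 p) = 0 := by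
  decide +kernel

def affineMap (π : Equiv.Perm (Fin 3)) (f : Equiv.Perm GF4) (t : GF4) (p : GF4 × GF4) :
    GF4 × GF4 :=
  (autotopism f t (π.symm 0) (netCoord (π.symm 0) p),
    autotopism f t (π.symm 1) (netCoord (π.symm 1) p))

theorem netCoord_affineMap (π : Equiv.Perm (Fin 3)) (f : Equiv.Perm GF4) (t : GF4)
    (p : GF4 × GF4) (i : Fin 3) :
    netCoord (π i) (affineMap π f t p) = autotopism f t i (netCoord i p) := by
  have hsum : ∑ k, autotopism f t (π.symm k) (netCoord (π.symm k) p) = 0 := by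
    rw [Equiv.sum_comp π.symm (fun k => autotopism f t k (netCoord k p)), Fin.sum_univ_three]
    exact autotopism_sum f t p
  rw [Fin.sum_univ_three] at hsum
  rw [affineMap, netCoord_mk _ _ _ hsum]
  obtain ⟨k, rfl⟩ := π.symm.surjective i
  rw [Equiv.apply_symm_apply]
  fin_cases k <;> rfl

theorem affineMap_bijective (π : Equiv.Perm (Fin 3)) (f : Equiv.Perm GF4) (t : GF4) :
    Function.Bijective (affineMap π f t) := by
  refine Finite.injective_iff_bijective.1 fun p q h => netCoord_ext p q fun i => ?_
  apply (autotopism f t i).injective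
  rw [← netCoord_affineMap π, ← netCoord_affineMap π, h]

abbrev NetData := Equiv.Perm (Fin 3) × Equiv.Perm (Fin 2) × Equiv.Perm GF4 × GF4

noncomputable def netPerm (d : NetData) : Equiv.Perm PlanePoint :=
  Equiv.sumCongr (Equiv.ofBijective _ (affineMap_bijective d.1 d.2.2.1 d.2.2.2))
    (Equiv.sumCongr d.1 d.2.1)

theorem netPerm_affine (d : NetData) (p : GF4 × GF4) :
    netPerm d (.inl p) = .inl (affineMap d.1 d.2.2.1 d.2.2.2 p) := rfl

theorem netPerm_direction (d : NetData) (i : Fin 3) :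
    netPerm d (.inr (.inl i)) = .inr (.inl (d.1 i)) := rfl

theorem netPerm_tangent (d : NetData) (e : Fin 2) :
    netPerm d (.inr (.inr e)) = .inr (.inr (d.2.1 e)) := rfl

theorem preservesNet_netPerm (d : NetData) : PreservesNet (netPerm d) := by
  rintro (⟨j, c⟩ | ⟨⟩)
  · obtain ⟨i, rfl⟩ := d.1.surjective j
    refine ⟨.inl (i, (autotopism d.2.2.1 d.2.2.2 i).symm c), ?_⟩
    rintro (p | i' | e)
    · rw [netPerm_affine, inc_net_affine, inc_net_affine, netCoord_affineMap,
        Equiv.eq_symm_apply]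
    · rw [netPerm_direction, inc_net_direction, inc_net_direction, d.1.injective.eq_iff]
    · rw [netPerm_tangent]
      exact iff_of_false (not_inc_net_tangent _ _ _) (not_inc_net_tangent _ _ _)
  · refine ⟨.inr (), ?_⟩
    rintro (p | y)
    · rw [netPerm_affine]
      exact iff_of_false (not_inc_infinity_affine _) (not_inc_infinity_affine _)
    · refine iff_of_true ?_ (inc_infinity _)
      exact inc_infinity _

theorem netPerm_injective : Function.Injective netPerm := by
  rintro ⟨π, ε, f, t⟩ ⟨π', ε', f', t'⟩ h
  obtain rfl : π = π' := by
    ext1 i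
    simpa [netPerm_direction] using congrArg (fun σ => σ (.inr (.inl i))) h
  obtain rfl : ε = ε' := by
    ext1 e
    simpa [netPerm_tangent] using congrArg (fun σ => σ (.inr (.inr e))) h
  have key : ∀ i c, autotopism f t i c = autotopism f' t' i c := by
    intro i c
    obtain ⟨p, rfl⟩ := exists_netCoord_eq i c
    have hp : affineMap π f t p = affineMap π f' t' p := by
      simpa [netPerm_affine] using congrArg (fun σ => σ (.inl p)) h
    rw [← netCoord_affineMap π, ← netCoord_affineMap π, hp]
  obtain rfl : f = f' := Equiv.ext (key 0)
  have : f 0 + t = f 0 + t' := key 1 0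
  rw [add_left_cancel this]

theorem PreservesNet.exists_perm {σ : Equiv.Perm PlanePoint} (hσ : PreservesNet σ) :
    ∃ τ : Equiv.Perm NetLine, ∀ k x, Inc (.inl k) (σ x) ↔ Inc (.inl (τ k)) x := by
  choose τ hτ using hσ
  have hinj : Function.Injective τ := fun k k' h => netLine_injective k k' fun x => by
    obtain ⟨x, rfl⟩ := σ.surjective x
    rw [hτ, hτ, h]
  exact ⟨Equiv.ofBijective τ (Finite.injective_iff_bijective.1 hinj), hτ⟩

theorem PreservesNet.netDegree_eq {σ : Equiv.Perm PlanePoint} (hσ : PreservesNet σ)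
    (x : PlanePoint) : netDegree (σ x) = netDegree x := by
  obtain ⟨τ, hτ⟩ := hσ.exists_perm
  exact Finset.card_equiv τ (by simp [hτ])

theorem PreservesNet.exists_components {σ : Equiv.Perm PlanePoint} (hσ : PreservesNet σ) :
    ∃ (π : Equiv.Perm (Fin 3)) (ε : Equiv.Perm (Fin 2)) (g : GF4 × GF4 → GF4 × GF4),
      Function.Surjective g ∧ (∀ i, σ (.inr (.inl i)) = .inr (.inl (π i))) ∧
      (∀ e, σ (.inr (.inr e)) = .inr (.inr (ε e))) ∧ ∀ p, σ (.inl p) = .inl (g p) := by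
  have hg : ∀ p, ∃ q, σ (.inl p) = .inl q := by
    intro p
    have := hσ.netDegree_eq (.inl p)
    rcases h : σ (.inl p) with q | i | e
    · exact ⟨q, rfl⟩
    · rw [h, netDegree_direction, netDegree_affine] at this; omega
    · rw [h, netDegree_tangent, netDegree_affine] at this; omega
  have hπ : ∀ i, ∃ k, σ (.inr (.inl i)) = .inr (.inl k) := by
    intro i
    have := hσ.netDegree_eq (.inr (.inl i))
    rcases h : σ (.inr (.inl i)) with q | k | e
    · rw [h, netDegree_direction, netDegree_affine] at this; omega
    · exact ⟨k, rfl⟩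
    · rw [h, netDegree_tangent, netDegree_direction] at this; omega
  have hε : ∀ e, ∃ k, σ (.inr (.inr e)) = .inr (.inr k) := by
    intro e
    have := hσ.netDegree_eq (.inr (.inr e))
    rcases h : σ (.inr (.inr e)) with q | k | e
    · rw [h, netDegree_tangent, netDegree_affine] at this; omega
    · rw [h, netDegree_tangent, netDegree_direction] at this; omega
    · exact ⟨e, rfl⟩
  choose g hg using hg
  choose π hπ using hπ
  choose ε hε using hε
  have hginj : Function.Injective g := fun p q h =>
    Sum.inl_injective (σ.injective ((hg p).trans (by rw [h, hg q])))
  have hπinj : Function.Injective π := fun p q h =>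
    Sum.inl_injective (Sum.inr_injective (σ.injective ((hπ p).trans (by rw [h, hπ q]))))
  have hεinj : Function.Injective ε := fun p q h =>
    Sum.inr_injective (Sum.inr_injective (σ.injective ((hε p).trans (by rw [h, hε q]))))
  exact ⟨Equiv.ofBijective π (Finite.injective_iff_bijective.1 hπinj),
    Equiv.ofBijective ε (Finite.injective_iff_bijective.1 hεinj), g,
    Finite.injective_iff_surjective.1 hginj, hπ, hε, hg⟩

theorem PreservesNet.netCoord_eq {σ : Equiv.Perm PlanePoint} (hσ : PreservesNet σ)
    {π : Equiv.Perm (Fin 3)} {g : GF4 × GF4 → GF4 × GF4}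
    (hπ : ∀ i, σ (.inr (.inl i)) = .inr (.inl (π i))) (hg : ∀ p, σ (.inl p) = .inl (g p))
    (i : Fin 3) {p q : GF4 × GF4} (hpq : netCoord i p = netCoord i q) :
    netCoord (π i) (g p) = netCoord (π i) (g q) := by
  obtain ⟨k, hk⟩ := hσ (.inl (π i, netCoord (π i) (g p)))
  have hp : Inc (.inl k) (.inl p) := by rw [← hk, hg, inc_net_affine]
  have hi : Inc (.inl k) (.inr (.inl i)) := by rw [← hk, hπ, inc_net_direction]
  have hq : Inc (.inl k) (.inl q) := by
    obtain ⟨i', c⟩ | ⟨⟩ := k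
    · obtain rfl := (inc_net_direction _ _ _).1 hi
      rw [inc_net_affine] at hp ⊢
      rw [← hpq, hp]
    · exact absurd hp (not_inc_infinity_affine p)
  rw [← hk, hg, inc_net_affine] at hq
  exact hq.symm

theorem add_eq_zero_iff_eq_gf4 : ∀ a b : GF4, a + b = 0 ↔ a = b := by decide +kernel

theorem eq_add_of_sum_zero : ∀ a b c : GF4, a + b + c = 0 → c = a + b := by decide +kernel

theorem exists_netPerm_eq {σ : Equiv.Perm PlanePoint} (hσ : PreservesNet σ) :
    ∃ d, netPerm d = σ := by
  obtain ⟨π, ε, g, hgsurj, hπ, hε, hg⟩ := hσ.exists_components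
  choose r hr using exists_netCoord_eq
  set F : Fin 3 → GF4 → GF4 := fun i c => netCoord (π i) (g (r i c)) with hF
  have hFg : ∀ i p, netCoord (π i) (g p) = F i (netCoord i p) := fun i p =>
    hσ.netCoord_eq hπ hg i (hr i _).symm
  have hsum : ∀ x y, F 0 x + F 1 y + F 2 (x + y) = 0 := by
    intro x y
    have h := netCoord_sum (g (x, y))
    rw [← Fin.sum_univ_three (fun k => netCoord k (g (x, y))),
      ← Equiv.sum_comp π, Fin.sum_univ_three, hFg, hFg, hFg] at h
    exact h
  have hbij : Function.Bijective (F 0) := by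
    refine Finite.surjective_iff_bijective.1 fun c => ?_
    obtain ⟨q, hq⟩ := exists_netCoord_eq (π 0) c
    obtain ⟨p, rfl⟩ := hgsurj q
    exact ⟨netCoord 0 p, by rw [← hFg, hq]⟩
  set f : Equiv.Perm GF4 := Equiv.ofBijective (F 0) hbij with hf
  have h2 : ∀ x, F 2 x = F 0 x + F 1 0 := fun x => by
    simpa using eq_add_of_sum_zero _ _ _ (hsum x 0)
  have h1 : ∀ y, F 1 y = F 0 y + (F 0 0 + F 1 0) := fun y => by
    have h := hsum 0 y
    rw [zero_add, h2] at h
    exact (add_eq_zero_iff_eq_gf4 _ _).1 (Eq.trans (by abel) h)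
  have hauto : ∀ i c, autotopism f (F 0 0 + F 1 0) i c = F i c := by
    intro i c
    fin_cases i
    · rfl
    · exact (h1 c).symm
    · have hc : F 0 0 + (F 0 0 + F 1 0) = F 1 0 := by
        rw [← add_assoc, (add_eq_zero_iff_eq_gf4 _ _).2 rfl, zero_add]
      change F 0 c + (F 0 0 + (F 0 0 + F 1 0)) = F 2 c
      rw [hc, h2]
  refine ⟨(π, ε, f, F 0 0 + F 1 0), Equiv.ext ?_⟩
  rintro (p | i | e)
  · rw [netPerm_affine, hg]
    congr 1
    refine netCoord_ext _ _ fun k => ?_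
    obtain ⟨i, rfl⟩ := π.surjective k
    rw [netCoord_affineMap, hFg, hauto]
  · rw [netPerm_direction, hπ]
  · rw [netPerm_tangent, hε]

theorem card_preservesNet : Nat.card {σ : Equiv.Perm PlanePoint // PreservesNet σ} = 1152 := by
  have hbij : Function.Bijective
      (fun d => ⟨netPerm d, preservesNet_netPerm d⟩ : NetData → {σ // PreservesNet σ}) :=
    ⟨fun d d' h => netPerm_injective (congrArg Subtype.val h), fun σ =>
      (exists_netPerm_eq σ.2).imp fun d hd => Subtype.ext hd⟩
  rw [← Nat.card_congr (Equiv.ofBijective _ hbij), Nat.card_eq_fintype_card]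
  simp [NetData, Fintype.card_perm, GF4.card_eq, Nat.factorial]

theorem ptVec_ne_zero : ∀ x : PlanePoint, ∃ k, ptVec x k ≠ 0 := by decide +kernel

theorem lnVec_ne_zero : ∀ j : PlaneLine, ∃ k, lnVec j k ≠ 0 := by decide +kernel

theorem exists_ptVec : ∀ a b c : GF4, (a ≠ 0 ∨ b ≠ 0 ∨ c ≠ 0) →
    ∃ x : PlanePoint, ∃ t : GF4, t ≠ 0 ∧ ∀ k, ![a, b, c] k = t * ptVec x k := by
  decide +kernel

theorem exists_lnVec : ∀ a b c : GF4, (a ≠ 0 ∨ b ≠ 0 ∨ c ≠ 0) →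
    ∃ j : PlaneLine, ∃ t : GF4, t ≠ 0 ∧ ∀ k, ![a, b, c] k = t * lnVec j k := by
  decide +kernel

theorem ne_zero_cases {M : Type*} [Zero M] {u : Fin 3 → M} (hu : u ≠ 0) :
    u 0 ≠ 0 ∨ u 1 ≠ 0 ∨ u 2 ≠ 0 := by
  by_contra! h
  exact hu (funext fun k => by fin_cases k <;> simp [h])

section Coordinates

variable {F : Type*} [Field F]

theorem apply_mk_rep_eq_zero_iff {V : Type*} [AddCommGroup V] [Module F V] (φ : V →ₗ[F] F)
    (v : V) (hv : v ≠ 0) : φ (Projectivization.mk F v hv).rep = 0 ↔ φ v = 0 := by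
  obtain ⟨a, ha⟩ := Projectivization.exists_smul_eq_mk_rep F v hv
  rw [← ha, Units.smul_def, map_smul, smul_eq_mul, mul_eq_zero]
  simp

/-- Four points, no three of them collinear, form a projective frame. -/
theorem exists_frame_basis (Fs : Finset (Projectivization F (Fin 3 → F))) (hcard : Fs.card = 4)
    (hconf : ∀ T : Finset (Projectivization F (Fin 3 → F)),
      T ⊆ Fs → T.card = 3 → ¬ CollinSet F ↑T) :
    ∃ (b : Module.Basis (Fin 3) F (Fin 3 → F)) (p : Fin 3 → Projectivization F (Fin 3 → F))
      (q : Projectivization F (Fin 3 → F)), (Fs : Set _) = {p 0, p 1, p 2, q} ∧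
      (∀ k, ∃ a : F, a • (p k).rep = b k) ∧ q.rep = b 0 + b 1 + b 2 := by
  classical
  have hline : ∀ x ∈ Fs, ∀ y ∈ Fs, ∀ z ∈ Fs, x ≠ y → x ≠ z → y ≠ z →
      ∀ φ : (Fin 3 → F) →ₗ[F] F, φ x.rep = 0 → φ y.rep = 0 → φ z.rep = 0 → φ = 0 := by
    intro x hx y hy z hz hxy hxz hyz φ h1 h2 h3
    by_contra hφ
    refine hconf {x, y, z} ?_ (Finset.card_eq_three.2 ⟨x, y, z, hxy, hxz, hyz, rfl⟩)
      ⟨_, ⟨φ, hφ, rfl⟩, ?_⟩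
    · intro t ht
      simp only [Finset.mem_insert, Finset.mem_singleton] at ht
      rcases ht with rfl | rfl | rfl <;> assumption
    · intro t ht
      simp only [Finset.coe_insert, Finset.coe_singleton, Set.mem_insert_iff,
        Set.mem_singleton_iff] at ht
      rcases ht with rfl | rfl | rfl <;> assumption
  obtain ⟨q, T, hqT, rfl, hT⟩ := Finset.card_eq_succ.1 hcard
  obtain ⟨x, y, z, hxy, hxz, hyz, rfl⟩ := Finset.card_eq_three.1 hT
  simp only [Finset.mem_insert, Finset.mem_singleton, not_or] at hqT
  obtain ⟨hqx, hqy, hqz⟩ := hqT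
  have hspan : ⊤ ≤ Submodule.span F (Set.range ![x.rep, y.rep, z.rep]) := by
    by_contra hlt
    obtain ⟨φ, hφ, hker⟩ := Submodule.exists_le_ker_of_lt_top _ (lt_top_iff_ne_top.2
      fun h => hlt h.ge)
    have hmem : ∀ k : Fin 3, φ (![x.rep, y.rep, z.rep] k) = 0 := fun k =>
      hker (Submodule.subset_span ⟨k, rfl⟩)
    exact hφ (hline x (by simp) y (by simp) z (by simp) hxy hxz hyz φ (hmem 0) (hmem 1) (hmem 2))
  set B := basisOfTopLeSpanOfCardEqFinrank ![x.rep, y.rep, z.rep] hspan (by simp) with hB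
  have hB' : ∀ k, B k = ![x.rep, y.rep, z.rep] k := fun k => by
    rw [hB, coe_basisOfTopLeSpanOfCardEqFinrank]
  have hBx : B 0 = x.rep := hB' 0
  have hBy : B 1 = y.rep := hB' 1
  have hBz : B 2 = z.rep := hB' 2
  have hcoord : ∀ k, B.coord k ≠ 0 := fun k h => by
    have := congrArg (fun φ => φ (B k)) h
    simp at this
  have hne : ∀ k, B.coord k q.rep ≠ 0 := by
    intro k hk
    fin_cases k
    · exact hcoord 0 (hline q (by simp) y (by simp) z (by simp) hqy hqz hyz _ hk
        (by simp [← hBy]) (by simp [← hBz]))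
    · exact hcoord 1 (hline q (by simp) x (by simp) z (by simp) hqx hqz hxz _ hk
        (by simp [← hBx]) (by simp [← hBz]))
    · exact hcoord 2 (hline q (by simp) x (by simp) y (by simp) hqx hqy hxy _ hk
        (by simp [← hBx]) (by simp [← hBy]))
  refine ⟨B.unitsSMul fun k => Units.mk0 _ (hne k), ![x, y, z], q, ?_, ?_, ?_⟩
  · ext t
    simp
    tauto
  · intro k
    refine ⟨B.coord k q.rep, ?_⟩
    rw [Module.Basis.unitsSMul_apply, Units.smul_def, Units.val_mk0, hB']
    fin_cases k <;> rfl
  · simp only [Module.Basis.unitsSMul_apply, Units.smul_def, Units.val_mk0]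
    conv_lhs => rw [← B.sum_repr q.rep, Fin.sum_univ_three]
    rfl

/-- The vector with given coordinates with respect to a basis. -/
noncomputable def coordVec (θ : GF4 ≃+* F) (b : Module.Basis (Fin 3) F (Fin 3 → F))
    (u : Fin 3 → GF4) : Fin 3 → F :=
  b.equivFun.symm fun k => θ (u k)

theorem equivFun_coordVec (θ : GF4 ≃+* F) (b : Module.Basis (Fin 3) F (Fin 3 → F))
    (u : Fin 3 → GF4) (k : Fin 3) : b.equivFun (coordVec θ b u) k = θ (u k) := by
  rw [coordVec, LinearEquiv.apply_symm_apply]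

theorem coordVec_ne_zero (θ : GF4 ≃+* F) (b : Module.Basis (Fin 3) F (Fin 3 → F))
    (x : PlanePoint) : coordVec θ b (ptVec x) ≠ 0 := by
  obtain ⟨k, hk⟩ := ptVec_ne_zero x
  intro h
  have := congrFun ((LinearEquiv.map_eq_zero_iff _).1 h) k
  exact hk (by simpa using this)

noncomputable def coordPoint (θ : GF4 ≃+* F) (b : Module.Basis (Fin 3) F (Fin 3 → F))
    (x : PlanePoint) : Projectivization F (Fin 3 → F) :=
  Projectivization.mk F (coordVec θ b (ptVec x)) (coordVec_ne_zero θ b x)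

theorem coordPoint_injective (θ : GF4 ≃+* F) (b : Module.Basis (Fin 3) F (Fin 3 → F)) :
    Function.Injective (coordPoint θ b) := by
  intro x y h
  obtain ⟨a, ha⟩ := (Projectivization.mk_eq_mk_iff' _ _ _ _ _).1 h
  refine ptVec_inj x y (θ.symm a) fun k => θ.injective ?_
  have := congrFun (congrArg b.equivFun ha) k
  rw [map_smul, Pi.smul_apply, equivFun_coordVec, equivFun_coordVec] at this
  simpa using this.symm

theorem coordPoint_eq_of_smul (θ : GF4 ≃+* F) (b : Module.Basis (Fin 3) F (Fin 3 → F))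
    {x : PlanePoint} {P : Projectivization F (Fin 3 → F)} {a : F}
    (h : a • P.rep = coordVec θ b (ptVec x)) : coordPoint θ b x = P := by
  rw [← P.mk_rep]
  exact (Projectivization.mk_eq_mk_iff' _ _ _ _ _).2 ⟨a, h⟩

theorem coordPoint_surjective (θ : GF4 ≃+* F) (b : Module.Basis (Fin 3) F (Fin 3 → F)) :
    Function.Surjective (coordPoint θ b) := by
  intro P
  set u : Fin 3 → GF4 := fun k => θ.symm (b.equivFun P.rep k) with hu
  have hu0 : u ≠ 0 := by
    intro h
    apply P.rep_nonzero
    apply b.equivFun.map_eq_zero_iff.1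
    funext k
    simpa [hu] using congrFun h k
  obtain ⟨x, t, ht, hx⟩ := exists_ptVec _ _ _ (ne_zero_cases hu0)
  refine ⟨x, coordPoint_eq_of_smul θ b (a := (θ t)⁻¹) ?_⟩
  have hθt : θ t ≠ 0 := by simpa using ht
  rw [inv_smul_eq_iff₀ hθt]
  apply b.equivFun.injective
  funext k
  have hk : u k = t * ptVec x k := by
    rw [← hx k]
    fin_cases k <;> rfl
  have : b.equivFun P.rep k = θ (u k) := by simp [hu]
  rw [this, hk, map_smul, Pi.smul_apply, equivFun_coordVec, map_mul, smul_eq_mul]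

noncomputable def coordEquiv (θ : GF4 ≃+* F) (b : Module.Basis (Fin 3) F (Fin 3 → F)) :
    PlanePoint ≃ Projectivization F (Fin 3 → F) :=
  Equiv.ofBijective _ ⟨coordPoint_injective θ b, coordPoint_surjective θ b⟩

theorem coordEquiv_apply (θ : GF4 ≃+* F) (b : Module.Basis (Fin 3) F (Fin 3 → F))
    (x : PlanePoint) : coordEquiv θ b x = coordPoint θ b x := rfl

/-- The linear functional with given values on a basis. -/
noncomputable def coordFunctional (θ : GF4 ≃+* F) (b : Module.Basis (Fin 3) F (Fin 3 → F))
    (j : PlaneLine) : (Fin 3 → F) →ₗ[F] F :=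
  b.constr F fun k => θ (lnVec j k)

theorem coordFunctional_rep_eq_zero_iff (θ : GF4 ≃+* F)
    (b : Module.Basis (Fin 3) F (Fin 3 → F)) (j : PlaneLine) (x : PlanePoint) :
    coordFunctional θ b j (coordPoint θ b x).rep = 0 ↔ Inc j x := by
  rw [coordPoint, apply_mk_rep_eq_zero_iff, coordFunctional, Module.Basis.constr_apply_fintype,
    coordVec, LinearEquiv.apply_symm_apply, Fin.sum_univ_three]
  simp only [smul_eq_mul, ← map_mul, ← map_add, map_eq_zero_iff θ θ.injective]
  rfl

theorem exists_coordinates [Fintype F] (hF : Fintype.card F = 4)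
    (Fs : Finset (Projectivization F (Fin 3 → F))) (hcard : Fs.card = 4)
    (hconf : ∀ T : Finset (Projectivization F (Fin 3 → F)),
      T ⊆ Fs → T.card = 3 → ¬ CollinSet F ↑T) :
    ∃ Φ : PlanePoint ≃ Projectivization F (Fin 3 → F),
      (∀ L, IsProjLine F L ↔ ∃ j, L = {P | Inc j (Φ.symm P)}) ∧
      Fs = frame.map Φ.toEmbedding := by
  classical
  obtain ⟨b, p, q, hFs, hp, hq⟩ := exists_frame_basis Fs hcard hconf
  have θ : GF4 ≃+* F := FiniteField.ringEquivOfCardEq (by rw [hF, GF4.card_eq])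
  have hfunctional : ∀ j, {P | coordFunctional θ b j P.rep = 0} =
      {P | Inc j ((coordEquiv θ b).symm P)} := by
    intro j
    ext P
    obtain ⟨x, rfl⟩ := (coordEquiv θ b).surjective P
    rw [Set.mem_ofPred_eq, Set.mem_ofPred_eq, Equiv.symm_apply_apply]
    exact coordFunctional_rep_eq_zero_iff θ b j x
  refine ⟨coordEquiv θ b, fun L => ⟨?_, ?_⟩, ?_⟩
  · rintro ⟨φ, hφ, rfl⟩
    set u : Fin 3 → GF4 := fun k => θ.symm (φ (b k)) with hu
    have hu0 : u ≠ 0 := by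
      intro h
      refine hφ (b.ext fun k => ?_)
      simpa [hu] using congrFun h k
    obtain ⟨j, t, ht, hj⟩ := exists_lnVec _ _ _ (ne_zero_cases hu0)
    refine ⟨j, ?_⟩
    rw [← hfunctional]
    have hφj : φ = θ t • coordFunctional θ b j := by
      refine b.ext fun k => ?_
      have hk : u k = t * lnVec j k := by
        rw [← hj k]
        fin_cases k <;> rfl
      have : φ (b k) = θ (u k) := by simp [hu]
      rw [this, hk]
      simp [coordFunctional]
    have hθt : θ t ≠ 0 := by simpa using ht
    ext P
    simp [hφj, hθt]
  · rintro ⟨j, rfl⟩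
    refine ⟨coordFunctional θ b j, ?_, (hfunctional j).symm⟩
    intro h
    obtain ⟨k, hk⟩ := lnVec_ne_zero j
    have := congrArg (fun φ => φ (b k)) h
    exact hk (by simpa [coordFunctional] using this)
  · have hpt : ∀ k, coordPoint θ b (![.inl (0, 0), .inl (1, 0), .inl (0, 1)] k) = p k := by
      intro k
      obtain ⟨a, ha⟩ := hp k
      refine coordPoint_eq_of_smul θ b (ha.trans ?_)
      rw [coordVec, Module.Basis.equivFun_symm_apply, Fin.sum_univ_three]
      fin_cases k <;> simp [ptVec, show (1 : GF4) + 1 = 0 by decide]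
    have hqt : coordPoint θ b (.inl (1, 1)) = q := by
      refine coordPoint_eq_of_smul θ b (a := 1) ?_
      rw [one_smul, hq, coordVec, Module.Basis.equivFun_symm_apply, Fin.sum_univ_three]
      simp [ptVec, show (1 : GF4) + 1 = 0 by decide]
    have h0 : coordPoint θ b (.inl (0, 0)) = p 0 := hpt 0
    have h1 : coordPoint θ b (.inl (1, 0)) = p 1 := hpt 1
    have h2 : coordPoint θ b (.inl (0, 1)) = p 2 := hpt 2
    apply Finset.coe_injective
    rw [hFs]
    simp [frame, coordEquiv_apply, h0, h1, h2, hqt]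

end Coordinates

theorem CF_eq_map_modelCode {F : Type*} [Field F] {Fs : Finset (Projectivization F (Fin 3 → F))}
    (Φ : PlanePoint ≃ Projectivization F (Fin 3 → F))
    (hlines : ∀ L, IsProjLine F L ↔ ∃ j, L = {P | Inc j (Φ.symm P)})
    (hFs : Fs = frame.map Φ.toEmbedding) :
    CF F Fs = modelCode.map
      (LinearEquiv.funCongrLeft (ZMod 2) (ZMod 2) Φ.symm).toLinearMap := by
  have hCDK : CDK F = (Submodule.span (ZMod 2) (Set.range lineWord)).map
      (LinearEquiv.funCongrLeft (ZMod 2) (ZMod 2) Φ.symm).toLinearMap := by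
    rw [Submodule.map_span, CDK, ← Set.range_comp]
    congr 1
    have hword : ∀ j, Set.indicator {P | Inc j (Φ.symm P)} (fun _ => (1 : ZMod 2)) =
        LinearEquiv.funCongrLeft (ZMod 2) (ZMod 2) Φ.symm (lineWord j) := by
      intro j
      funext P
      simp [Set.indicator_apply, LinearEquiv.funCongrLeft, LinearMap.funLeft, lineWord]
    ext w
    constructor
    · rintro ⟨L, hL, rfl⟩
      obtain ⟨j, rfl⟩ := (hlines L).1 hL
      exact ⟨j, (hword j).symm⟩
    · rintro ⟨j, rfl⟩
      exact ⟨_, (hlines _).2 ⟨j, rfl⟩, (hword j).symm⟩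
  ext w
  obtain ⟨v, rfl⟩ := (LinearEquiv.funCongrLeft (ZMod 2) (ZMod 2) Φ.symm).surjective w
  have hsum : (∑ x ∈ Fs, LinearMap.proj x : (_ → ZMod 2) →ₗ[ZMod 2] ZMod 2)
      (LinearEquiv.funCongrLeft (ZMod 2) (ZMod 2) Φ.symm v) =
      (∑ x ∈ frame, LinearMap.proj x : (_ → ZMod 2) →ₗ[ZMod 2] ZMod 2) v := by
    simp [hFs, LinearMap.sum_apply, LinearEquiv.funCongrLeft, LinearMap.funLeft]
  have hmap : ∀ S : Submodule (ZMod 2) (PlanePoint → ZMod 2),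
      LinearEquiv.funCongrLeft (ZMod 2) (ZMod 2) Φ.symm v ∈ S.map
        (LinearEquiv.funCongrLeft (ZMod 2) (ZMod 2) Φ.symm).toLinearMap ↔ v ∈ S := fun S =>
    Function.Injective.mem_set_image (LinearEquiv.funCongrLeft (ZMod 2) (ZMod 2) Φ.symm).injective
  rw [hmap, CF, hCDK, Submodule.mem_inf, hmap, LinearMap.mem_ker, hsum, modelCode,
    Submodule.mem_inf, LinearMap.mem_ker]

/-- for a four-point subset `F ⊆ P²(F₄)` with no three points collinear, the
group of permutations of the 21 points of `P²(F₄)` preserving the code `C_F` has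
order 1152. -/
theorem aut_code_A (F : Type*) [Field F] [Fintype F] (hF : Fintype.card F = 4)
    (Fs : Finset (Projectivization F (Fin 3 → F))) (hcard : Fs.card = 4)
    (hconf : ∀ T : Finset (Projectivization F (Fin 3 → F)),
      T ⊆ Fs → T.card = 3 → ¬ CollinSet F ↑T) :
    Nat.card {σ : Equiv.Perm (Projectivization F (Fin 3 → F)) |
      Submodule.map (LinearMap.funLeft (ZMod 2) (ZMod 2) ⇑σ) (CF F Fs) = CF F Fs} = 1152 := by
  obtain ⟨Φ, hlines, hFs⟩ := exists_coordinates hF Fs hcard hconf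
  have hcode := CF_eq_map_modelCode Φ hlines hFs
  rw [← card_preservesNet]
  refine Nat.card_congr ((Φ.permCongr.symm).subtypeEquiv fun σ => ?_)
  rw [Set.mem_ofPred_eq, ← map_modelCode_eq_iff, hcode, ← Submodule.map_comp]
  have hcomm : (LinearMap.funLeft (ZMod 2) (ZMod 2) σ) ∘ₗ
      (LinearEquiv.funCongrLeft (ZMod 2) (ZMod 2) Φ.symm).toLinearMap =
      (LinearEquiv.funCongrLeft (ZMod 2) (ZMod 2) Φ.symm).toLinearMap ∘ₗ
        (LinearMap.funLeft (ZMod 2) (ZMod 2) (Φ.permCongr.symm σ)) := by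
    ext w P
    simp [LinearEquiv.funCongrLeft, LinearMap.funLeft, Equiv.permCongr_symm]
  rw [hcomm, Submodule.map_comp]
  exact (Submodule.map_injective_of_injective
    (LinearEquiv.funCongrLeft (ZMod 2) (ZMod 2) Φ.symm).injective).eq_iff
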